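/- arXiv:1108.5393 — 6 statements merged into one kernel-verified Lean document; each statement's English description precedes it below -/
import Mathlib

section
/- Let P be a 2×2 matrix with entries in O = ℤ[ζ₅] that is Hermitian (P* = P), unimodular (det P is a unit of O), and totally positive (for every field embedding ψ : K → ℂ, the complex matrix obtained by applying ψ entrywise to P is positive definite Hermitian). Then there exists a 2×2 matrix C with entries in O whose determinant is a unit of O such that P = C*C, where C* is the conjugate transpose of C. -/
open ComplexOrder

/-- Data used in the reduction argument. -/
structure RedSetup {K : Type} [Field K] (S : Subring K) (σ : K →+* K) (τ : K)
    (f g : K →+* ℂ) (s t : ℝ) : Prop where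
  invol : ∀ x, σ (σ x) = x
  stable : ∀ x ∈ S, σ x ∈ S
  tau_mem : τ ∈ S
  tau_fix : σ τ = τ
  tau_eq : τ * (1 + τ) = 1
  real : ∀ a ∈ S, σ a = a → ∃ m n : ℤ, a = m + n * τ
  ftau : f τ = s
  gtau : g τ = t
  hsum : s + t = -1
  hprod : s * t = -1
  fconj : ∀ x, f (σ x) = (starRingEnd ℂ) (f x)
  gconj : ∀ x, g (σ x) = (starRingEnd ℂ) (g x)
  cov : ∀ x : K, ∃ q ∈ S, Complex.normSq (f (x - q)) + Complex.normSq (g (x - q)) ≤ 1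

/-- Decomposability. -/
def RedDec {K : Type} [Field K] (S : Subring K) (σ : K →+* K) (a b d : K) : Prop :=
  ∃ p ∈ S, ∃ q ∈ S, ∃ r ∈ S, ∃ u ∈ S,
    a = σ p * p + σ r * r ∧ b = σ p * q + σ r * u ∧ d = σ q * q + σ u * u

namespace RedSetup

variable {K : Type} [Field K] {S : Subring K} {σ : K →+* K} {τ : K}
    {f g : K →+* ℂ} {s t : ℝ}

theorem dec_scale {a b d u v : K} (hv : v ∈ S)
    (hvf : σ v = v) (huv : u * v = 1)
    (h : RedDec S σ (u * u * a) (u * b) d) : RedDec S σ a b d := by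
  obtain ⟨p, hp, q, hq, r, hr, w, hw, h1, h2, h3⟩ := h
  refine ⟨p * v, S.mul_mem hp hv, q, hq, r * v, S.mul_mem hr hv, w, hw, ?_, ?_, h3⟩
  · simp only [map_mul, hvf]
    linear_combination (v * v) * h1 - a * (u * v + 1) * huv
  · simp only [map_mul, hvf]
    linear_combination v * h2 - b * huv

theorem dec_scale2 {a b d u v : K} (hu : u ∈ S) (hv : v ∈ S) (huf : σ u = u)
    (hvf : σ v = v) (huv : u * v = 1)
    (h : RedDec S σ (u * u * a) b (v * v * d)) : RedDec S σ a b d := by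
  obtain ⟨p, hp, q, hq, r, hr, w, hw, h1, h2, h3⟩ := h
  refine ⟨p * v, S.mul_mem hp hv, q * u, S.mul_mem hq hu, r * v, S.mul_mem hr hv, w * u,
    S.mul_mem hw hu, ?_, ?_, ?_⟩
  · simp only [map_mul, hvf]
    linear_combination (v * v) * h1 - a * (u * v + 1) * huv
  · simp only [map_mul, hvf]
    linear_combination h2 - (σ p * q + σ r * w) * huv
  · simp only [map_mul, huf]
    linear_combination (u * u) * h3 - d * (u * v + 1) * huv

theorem dec_shear {a b d k : K} (hi : ∀ x, σ (σ x) = x) (hk : k ∈ S) (ha : σ a = a)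
    (h : RedDec S σ a (b - a * k) (d - σ k * b - σ b * k + a * (σ k * k))) :
    RedDec S σ a b d := by
  obtain ⟨p, hp, q, hq, r, hr, w, hw, h1, h2, h3⟩ := h
  refine ⟨p, hp, q + p * k, S.add_mem hq (S.mul_mem hp hk), r, hr, w + r * k,
    S.add_mem hw (S.mul_mem hr hk), h1, ?_, ?_⟩
  · linear_combination h2 + k * h1
  · have h4 := congrArg σ h2
    simp only [map_sub, map_add, map_mul, hi, ha] at h4
    simp only [map_add, map_mul]
    linear_combination h3 + σ k * h2 + k * h4 + σ k * k * h1

theorem dec_swap {a b d : K} (hi : ∀ x, σ (σ x) = x)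
    (h : RedDec S σ d (σ b) a) : RedDec S σ a b d := by
  obtain ⟨p, hp, q, hq, r, hr, w, hw, h1, h2, h3⟩ := h
  refine ⟨q, hq, p, hp, w, hw, r, hr, h3, ?_, h1⟩
  have h4 := congrArg σ h2
  simp only [map_add, map_mul, hi] at h4
  linear_combination h4

theorem int_pos (H : RedSetup S σ τ f g s t) {m n : ℤ}
    (h1 : 0 < (m : ℝ) + n * s) (h2 : 0 < (m : ℝ) + n * t) :
    0 < 2 * m - n ∧ 0 < m * m - m * n - n * n := by
  have e1 : ((2 * m - n : ℤ) : ℝ) = (m + n * s) + (m + n * t) := by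
    push_cast; linear_combination -(n : ℝ) * H.hsum
  have e2 : ((m * m - m * n - n * n : ℤ) : ℝ) = (m + n * s) * (m + n * t) := by
    push_cast; linear_combination -(m : ℝ) * n * H.hsum - (n : ℝ) * n * H.hprod
  constructor
  · have : (0 : ℝ) < ((2 * m - n : ℤ) : ℝ) := by rw [e1]; positivity
    exact_mod_cast this
  · have : (0 : ℝ) < ((m * m - m * n - n * n : ℤ) : ℝ) := by rw [e2]; positivity
    exact_mod_cast this

/-- Balancing by units. -/
theorem balance (H : RedSetup S σ τ f g s t) : ∀ (k : ℕ) (m n : ℤ), 2 * m - n ≤ k →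
    0 < 2 * m - n → 0 < m * m - m * n - n * n →
    ∃ u ∈ S, ∃ v ∈ S, σ u = u ∧ σ v = v ∧ u * v = 1 ∧ ∃ m' n' : ℤ,
      u * u * (m + n * τ) = m' + n' * τ ∧ 0 < 2 * m' - n' ∧
      m' * m' - m' * n' - n' * n' = m * m - m * n - n * n ∧ 0 ≤ m' - 3 * n' ∧
      0 ≤ m' + 2 * n' := by
  intro k
  have ht := H.tau_eq
  have hp : (1 + τ) ∈ S := S.add_mem S.one_mem H.tau_mem
  have hpf : σ (1 + τ) = 1 + τ := by simp [H.tau_fix]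
  induction k with
  | zero => intro m n h1 h2; push_cast at h1; omega
  | succ k ih =>
    intro m n h1 h2 h3
    by_cases c1 : 0 ≤ m - 3 * n
    · by_cases c2 : 0 ≤ m + 2 * n
      · exact ⟨1, S.one_mem, 1, S.one_mem, by simp, by simp, by simp, m, n, by simp, h2, rfl,
          c1, c2⟩
      · -- multiply by `(1+τ)^2 = 2 + τ`
        obtain ⟨u, hu, v, hv, hu1, hv1, huv, m', n', e, r⟩ := ih (2 * m + n) (m + n)
          (by push_cast at h1; omega) (by nlinarith) (by nlinarith)
        refine ⟨u * (1 + τ), S.mul_mem hu hp, v * τ, S.mul_mem hv H.tau_mem, by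
          rw [map_mul, hu1, hpf], by rw [map_mul, hv1, H.tau_fix], ?_, m', n', ?_, r.1, ?_,
          r.2.2⟩
        · linear_combination huv + u * v * ht
        · push_cast at e
          linear_combination e + u * u * (m + n + n * τ) * ht
        · rw [r.2.1]; ring
    · -- multiply by `τ^2 = 1 - τ`
      obtain ⟨u, hu, v, hv, hu1, hv1, huv, m', n', e, r⟩ := ih (m - n) (2 * n - m)
          (by push_cast at h1; omega) (by nlinarith) (by nlinarith)
      refine ⟨u * τ, S.mul_mem hu H.tau_mem, v * (1 + τ), S.mul_mem hv hp, by
          rw [map_mul, hu1, H.tau_fix], by rw [map_mul, hv1, hpf], ?_, m', n', ?_, r.1, ?_,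
          r.2.2⟩
      · linear_combination huv + u * v * ht
      · push_cast at e
        linear_combination e + u * u * (m - n + n * τ) * ht
      · rw [r.2.1]; ring

theorem int_one {m n : ℤ} (h0 : 0 < 2 * m - n) (hN : m * m - m * n - n * n = 1)
    (h1 : 0 ≤ m - 3 * n) (h2 : 0 ≤ m + 2 * n) : m = 1 ∧ n = 0 := by
  have h5 : 5 * (n * n) ≤ 1 := by nlinarith
  have hn : n = 0 := by
    by_contra h
    have : 0 < n * n := mul_self_pos.mpr h
    omega
  subst hn
  have : m ≤ 1 := by nlinarith
  omega

theorem int_four {m n : ℤ} (hN : 0 < m * m - m * n - n * n)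
    (hN1 : m * m - m * n - n * n ≠ 1) : 4 ≤ m * m - m * n - n * n := by
  by_contra h
  have hc : m * m - m * n - n * n = 2 ∨ m * m - m * n - n * n = 3 := by omega
  have key : (2 * m - n) * (2 * m - n) = 4 * (m * m - m * n - n * n) + 5 * (n * n) := by ring
  generalize 2 * m - n = w at key
  generalize n * n = z at *
  have hw : w % 5 = 0 ∨ w % 5 = 1 ∨ w % 5 = 2 ∨ w % 5 = 3 ∨ w % 5 = 4 := by omega
  have h6 : (w * w) % 5 = 3 ∨ (w * w) % 5 = 2 := by omega
  rw [Int.mul_emod] at h6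
  rcases hw with h | h | h | h | h <;> rw [h] at h6 <;> omega

theorem real_ineq {a b y z p q : ℝ} (ha : 0 < a) (hb : 0 < b) (hy : 0 ≤ y) (hz : 0 ≤ z)
    (hyz : y + z ≤ 1) (h : a * a + b * b < (a * b) * (a * b))
    (hp : a * p = 1 + a * a * y) (hq : b * q = 1 + b * b * z) : p * q < a * b := by
  have e : p * q * (a * b) = (1 + a * a * y) * (1 + b * b * z) := by rw [← hp, ← hq]; ring
  set M := a * b with hM
  have hMp : 0 < M := by positivity
  have e2 : (1 + a * a * y) * (1 + b * b * z) < M * M := by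
    have i1 : 4 * (((1 + a * a * y) * (b * b)) * ((1 + b * b * z) * (a * a))) ≤
        (((1 + a * a * y) * (b * b)) + ((1 + b * b * z) * (a * a))) ^ 2 := by
      nlinarith [sq_nonneg (((1 + a * a * y) * (b * b)) - ((1 + b * b * z) * (a * a)))]
    have i2 : ((1 + a * a * y) * (b * b)) + ((1 + b * b * z) * (a * a)) < 2 * (M * M) := by
      have : ((1 + a * a * y) * (b * b)) + ((1 + b * b * z) * (a * a)) =
        a * a + b * b + M * M * (y + z) := by rw [hM]; ring
      rw [this]
      nlinarith [mul_pos hMp hMp]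
    have i3 : 0 ≤ ((1 + a * a * y) * (b * b)) + ((1 + b * b * z) * (a * a)) := by positivity
    have i4 : (((1 + a * a * y) * (b * b)) + ((1 + b * b * z) * (a * a))) ^ 2
        < (2 * (M * M)) ^ 2 := by gcongr
    have i5 : (1 + a * a * y) * (1 + b * b * z) * (M * M) < (M * M) * (M * M) := by
      have : (1 + a * a * y) * (1 + b * b * z) * (M * M) =
        ((1 + a * a * y) * (b * b)) * ((1 + b * b * z) * (a * a)) := by rw [hM]; ring
      rw [this]; nlinarith
    exact lt_of_mul_lt_mul_right i5 (by positivity)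
  rw [← e] at e2
  exact lt_of_mul_lt_mul_right e2 hMp.le

theorem main (H : RedSetup S σ τ f g s t) : ∀ (k : ℕ) (m n : ℤ) (b d : K),
    m * m - m * n - n * n ≤ k → 0 < (m : ℝ) + n * s → 0 < (m : ℝ) + n * t →
    b ∈ S → d ∈ S → σ d = d → (m + n * τ) * d - b * σ b = 1 →
    RedDec S σ (m + n * τ) b d := by
  intro k
  induction k with
  | zero =>
    intro m n b d h1 h2 h3
    have := (H.int_pos h2 h3).2
    push_cast at h1
    omega
  | succ k ih =>
    intro m n b d hk hs ht hb hd hdf hdet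
    obtain ⟨h1, h2⟩ := H.int_pos hs ht
    obtain ⟨u, hu, v, hv, huf, hvf, huv, m', n', e, r1, r2, r3, r4⟩ :=
      H.balance (2 * m - n).toNat m n (by omega) h1 h2
    refine dec_scale2 hu hv huf hvf huv ?_
    rw [e]
    have hd' : v * v * d ∈ S := S.mul_mem (S.mul_mem hv hv) hd
    have hdf' : σ (v * v * d) = v * v * d := by rw [map_mul, map_mul, hvf, hdf]
    have hdet' : (m' + n' * τ) * (v * v * d) - b * σ b = 1 := by
      rw [← e]
      linear_combination hdet + (m + n * τ) * d * (u * v + 1) * huv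
    generalize v * v * d = c at *
    clear hdet hdf hd d
    rw [← r2] at hk h2
    clear e r2 huv hs ht h1
    by_cases hN1 : m' * m' - m' * n' - n' * n' = 1
    · obtain ⟨rfl, rfl⟩ := int_one r1 hN1 r3 r4
      refine ⟨1, S.one_mem, b, hb, 0, S.zero_mem, 1, S.one_mem, by simp, by simp, ?_⟩
      simp only [map_one]
      push_cast at hdet'
      linear_combination hdet'
    have hN4 := int_four h2 hN1
    obtain ⟨A, hA⟩ : ∃ A : ℝ, A = m' + n' * s := ⟨_, rfl⟩
    obtain ⟨B, hB⟩ : ∃ B : ℝ, B = m' + n' * t := ⟨_, rfl⟩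
    have eS : ((2 * m' - n' : ℤ) : ℝ) = A + B := by
      push_cast; rw [hA, hB]; linear_combination -(n' : ℝ) * H.hsum
    have eN : ((m' * m' - m' * n' - n' * n' : ℤ) : ℝ) = A * B := by
      push_cast; rw [hA, hB]
      linear_combination -(m' : ℝ) * n' * H.hsum - (n' : ℝ) * n' * H.hprod
    have hABs : 0 < A + B := by rw [← eS]; exact_mod_cast r1
    have hABp : 0 < A * B := by rw [← eN]; exact_mod_cast h2
    have hA0 : 0 < A := by
      by_contra h
      nlinarith [sq_nonneg A]
    have hB0 : 0 < B := by
      by_contra h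
      nlinarith [sq_nonneg B]
    have hsq : A * A + B * B < (A * B) * (A * B) := by
      have : A * A + B * B = (A + B) * (A + B) - 2 * (A * B) := by ring
      rw [this, ← eS, ← eN]
      have : (2 * m' - n') * (2 * m' - n') - 2 * (m' * m' - m' * n' - n' * n') <
        (m' * m' - m' * n' - n' * n') * (m' * m' - m' * n' - n' * n') := by
        nlinarith [mul_nonneg r3 r4]
      exact_mod_cast this
    have fa : f (m' + n' * τ) = A := by simp [H.ftau, hA]
    have ga : g (m' + n' * τ) = B := by simp [H.gtau, hB]
    have haf : σ (m' + n' * τ) = m' + n' * τ := by simp [H.tau_fix]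
    have haS : (m' + n' * τ) ∈ S :=
      S.add_mem (intCast_mem S _) (S.mul_mem (intCast_mem S _) H.tau_mem)
    obtain ⟨a, hadef⟩ : ∃ a : K, a = m' + n' * τ := ⟨_, rfl⟩
    rw [← hadef] at fa ga haf haS hdet' ⊢
    have ha0 : a ≠ 0 := by
      rintro rfl
      rw [map_zero] at fa
      have : (0 : ℝ) = A := by exact_mod_cast fa
      linarith
    obtain ⟨q, hq, hqle⟩ := H.cov (b / a)
    refine dec_shear H.invol hq haf (dec_swap H.invol ?_)
    have hbq : b - a * q = a * (b / a - q) := by field_simp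
    have hb2 : b - a * q ∈ S := S.sub_mem hb (S.mul_mem haS hq)
    have hd2 : c - σ q * b - σ b * q + a * (σ q * q) ∈ S :=
      S.add_mem (S.sub_mem (S.sub_mem hd' (S.mul_mem (H.stable q hq) hb))
        (S.mul_mem (H.stable b hb) hq)) (S.mul_mem haS (S.mul_mem (H.stable q hq) hq))
    have hd2f : σ (c - σ q * b - σ b * q + a * (σ q * q)) =
        c - σ q * b - σ b * q + a * (σ q * q) := by
      simp only [map_add, map_sub, map_mul, H.invol, haf, hdf']
      ring
    have hdet2 : a * (c - σ q * b - σ b * q + a * (σ q * q)) =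
        1 + (b - a * q) * σ (b - a * q) := by
      simp only [map_sub, map_mul, haf]
      linear_combination hdet'
    obtain ⟨m2, n2, e2⟩ := H.real _ hd2 hd2f
    rw [e2] at hdet2 ⊢
    have hdet3 : a * (m2 + n2 * τ) = 1 + a * a * ((b / a - q) * σ (b / a - q)) := by
      rw [hdet2, hbq, map_mul, haf]; ring
    have F : A * (m2 + n2 * s) = 1 + A * A * Complex.normSq (f (b / a - q)) := by
      have := congrArg f hdet3
      simp only [map_add, map_mul, map_one, fa, H.ftau, H.fconj, map_intCast,
        Complex.mul_conj] at this
      exact_mod_cast this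
    have G : B * (m2 + n2 * t) = 1 + B * B * Complex.normSq (g (b / a - q)) := by
      have := congrArg g hdet3
      simp only [map_add, map_mul, map_one, ga, H.gtau, H.gconj, map_intCast,
        Complex.mul_conj] at this
      exact_mod_cast this
    have y0 := Complex.normSq_nonneg (f (b / a - q))
    have z0 := Complex.normSq_nonneg (g (b / a - q))
    have hlt := real_ineq hA0 hB0 y0 z0 hqle hsq F G
    have p1 : 0 < (m2 : ℝ) + n2 * s := by
      refine pos_of_mul_pos_right (a := A) ?_ hA0.le
      rw [F]; positivity
    have p2 : 0 < (m2 : ℝ) + n2 * t := by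
      refine pos_of_mul_pos_right (a := B) ?_ hB0.le
      rw [G]; positivity
    have eN2 : ((m2 * m2 - m2 * n2 - n2 * n2 : ℤ) : ℝ) = (m2 + n2 * s) * (m2 + n2 * t) := by
      push_cast
      linear_combination -(m2 : ℝ) * n2 * H.hsum - (n2 : ℝ) * n2 * H.hprod
    rw [← eN2, ← eN] at hlt
    have hlt' : m2 * m2 - m2 * n2 - n2 * n2 < m' * m' - m' * n' - n' * n' := by
      exact_mod_cast hlt
    refine ih m2 n2 _ _ (by push_cast at hk; omega) p1 p2 (H.stable _ hb2) haS haf ?_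
    rw [H.invol, mul_comm, hdet2]; ring

/-- Unit determinant version. -/
theorem main2 (H : RedSetup S σ τ f g s t) {a b d w : K} (ha : a ∈ S) (hb : b ∈ S) (hd : d ∈ S)
    (hw : w ∈ S) (haf : σ a = a) (hdf : σ d = d) (hdet : (a * d - b * σ b) * w = 1)
    (hfa : 0 < (f a).re) (hga : 0 < (g a).re)
    (hfe : 0 < (f (a * d - b * σ b)).re) (hge : 0 < (g (a * d - b * σ b)).re) :
    RedDec S σ a b d := by
  have heS : a * d - b * σ b ∈ S := S.sub_mem (S.mul_mem ha hd) (S.mul_mem hb (H.stable b hb))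
  have hef : σ (a * d - b * σ b) = a * d - b * σ b := by
    simp only [map_sub, map_mul, haf, hdf, H.invol]; ring
  have hwf : σ w = w := by
    have := congrArg σ hdet
    rw [map_mul, hef, map_one, ← hdet] at this
    exact mul_left_cancel₀ (left_ne_zero_of_mul_eq_one hdet) this
  obtain ⟨m, n, em⟩ := H.real _ heS hef
  obtain ⟨m2, n2, em2⟩ := H.real _ hw hwf
  have hfm : ∀ m n : ℤ, f (m + n * τ) = ((m + n * s : ℝ) : ℂ) := by
    intro m n; simp [H.ftau]
  have hgm : ∀ m n : ℤ, g (m + n * τ) = ((m + n * t : ℝ) : ℂ) := by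
    intro m n; simp [H.gtau]
  rw [em, hfm, Complex.ofReal_re] at hfe
  rw [em, hgm, Complex.ofReal_re] at hge
  obtain ⟨h1, h2⟩ := H.int_pos hfe hge
  have hN : m * m - m * n - n * n = 1 := by
    rw [em, em2] at hdet
    have F := congrArg f hdet
    have G := congrArg g hdet
    rw [map_mul, hfm, hfm, map_one] at F
    rw [map_mul, hgm, hgm, map_one] at G
    have F' : ((m : ℝ) + n * s) * (m2 + n2 * s) = 1 := by exact_mod_cast F
    have G' : ((m : ℝ) + n * t) * (m2 + n2 * t) = 1 := by exact_mod_cast G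
    have eN : ∀ m n : ℤ, ((m * m - m * n - n * n : ℤ) : ℝ) = (m + n * s) * (m + n * t) := by
      intro m n
      push_cast
      linear_combination -(m : ℝ) * n * H.hsum - (n : ℝ) * n * H.hprod
    have : (m * m - m * n - n * n) * (m2 * m2 - m2 * n2 - n2 * n2) = 1 := by
      have : ((m * m - m * n - n * n : ℤ) : ℝ) * ((m2 * m2 - m2 * n2 - n2 * n2 : ℤ) : ℝ) = 1 := by
        rw [eN, eN]
        linear_combination ((m : ℝ) + n * t) * (m2 + n2 * t) * F' + G'
      exact_mod_cast this
    rcases Int.eq_one_or_neg_one_of_mul_eq_one this with h | h <;> omega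
  obtain ⟨u, hu, v, hv, huf, hvf, huv, m', n', e, r1, r2, r3, r4⟩ :=
      H.balance (2 * m - n).toNat m n (by omega) h1 h2
  rw [hN] at r2
  obtain ⟨rfl, rfl⟩ := int_one r1 r2 r3 r4
  refine dec_scale hv hvf huv ?_
  have hauf : σ (u * u * a) = u * u * a := by rw [map_mul, map_mul, huf, haf]
  have hauS : u * u * a ∈ S := S.mul_mem (S.mul_mem hu hu) ha
  obtain ⟨m3, n3, e3⟩ := H.real _ hauS hauf
  have hureal : ∀ x : K, σ x = x → ∃ r : ℝ, f x = r := by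
    intro x hx
    have := H.fconj x
    rw [hx] at this
    exact ⟨_, (Complex.conj_eq_iff_re.mp this.symm).symm⟩
  have hureal' : ∀ x : K, σ x = x → ∃ r : ℝ, g x = r := by
    intro x hx
    have := H.gconj x
    rw [hx] at this
    exact ⟨_, (Complex.conj_eq_iff_re.mp this.symm).symm⟩
  have p1 : 0 < (m3 : ℝ) + n3 * s := by
    obtain ⟨r, hr⟩ := hureal u huf
    have hr0 : r ≠ 0 := by
      rintro rfl
      have : f u = 0 := by simpa using hr
      exact left_ne_zero_of_mul_eq_one huv ((map_eq_zero f).mp this)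
    have := congrArg (fun x => (f x).re) e3
    simp only [hfm, map_mul, hr, Complex.ofReal_re, ← Complex.ofReal_mul,
      Complex.re_ofReal_mul] at this
    rw [← this]
    have := mul_self_pos.mpr hr0
    positivity
  have p2 : 0 < (m3 : ℝ) + n3 * t := by
    obtain ⟨r, hr⟩ := hureal' u huf
    have hr0 : r ≠ 0 := by
      rintro rfl
      have : g u = 0 := by simpa using hr
      exact left_ne_zero_of_mul_eq_one huv ((map_eq_zero g).mp this)
    have := congrArg (fun x => (g x).re) e3
    simp only [hgm, map_mul, hr, Complex.ofReal_re, ← Complex.ofReal_mul,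
      Complex.re_ofReal_mul] at this
    rw [← this]
    have := mul_self_pos.mpr hr0
    positivity
  rw [e3]
  refine H.main (m3 * m3 - m3 * n3 - n3 * n3).toNat m3 n3 _ _ (by omega) p1 p2
    (S.mul_mem hu hb) hd hdf ?_
  rw [← e3, map_mul, huf]
  push_cast at e
  linear_combination e + u * u * em

end RedSetup

theorem exists_lower {a b c d e : ℝ} (ha : 2 < a) (hb : 2 < b) (hc : 2 < c) (hd : 2 < d)
    (he : 2 < e) : ∃ r : ℝ, 2 < r ∧ r ≤ a ∧ r ≤ b ∧ r ≤ c ∧ r ≤ d ∧ r ≤ e :=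
  ⟨min a (min b (min c (min d e))), by simp [*], by simp, by simp, by simp, by simp, by simp⟩

theorem cov_sorted (x0 x1 x2 x3 x4 : ℝ) (h0 : 0 ≤ x0) (h01 : x0 ≤ x1) (h12 : x1 ≤ x2)
    (h23 : x2 ≤ x3) (h34 : x3 ≤ x4) (h4 : x4 ≤ 1) :
    ∃ n0 n1 n2 n3 n4 : ℤ,
      5 * ((x0 - n0) ^ 2 + (x1 - n1) ^ 2 + (x2 - n2) ^ 2 + (x3 - n3) ^ 2 + (x4 - n4) ^ 2)
      - ((x0 - n0) + (x1 - n1) + (x2 - n2) + (x3 - n3) + (x4 - n4)) ^ 2 ≤ 2 := by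
  by_contra hc
  push Not at hc
  have c0 := hc 0 0 0 0 0
  have c1 := hc (-1) 0 0 0 0
  have c2 := hc (-1) (-1) 0 0 0
  have c3 := hc (-1) (-1) (-1) 0 0
  have c4 := hc (-1) (-1) (-1) (-1) 0
  push_cast at c0 c1 c2 c3 c4
  obtain ⟨e, he, b0, b1, b2, b3, b4⟩ := exists_lower c0 c1 c2 c3 c4
  have d0 := mul_nonneg (sub_nonneg.mpr (show x4 - x0 ≤ 1 by linarith)) (sub_nonneg.mpr b0)
  have d1 := mul_nonneg (sub_nonneg.mpr h01) (sub_nonneg.mpr b1)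
  have d2 := mul_nonneg (sub_nonneg.mpr h12) (sub_nonneg.mpr b2)
  have d3 := mul_nonneg (sub_nonneg.mpr h23) (sub_nonneg.mpr b3)
  have d4 := mul_nonneg (sub_nonneg.mpr h34) (sub_nonneg.mpr b4)
  linarith [sq_nonneg (x1 - x0 - 1 / 5), sq_nonneg (x2 - x1 - 1 / 5), sq_nonneg (x3 - x2 - 1 / 5),
    sq_nonneg (x4 - x3 - 1 / 5), sq_nonneg (x2 - x0 - 2 / 5), sq_nonneg (x3 - x1 - 2 / 5),
    sq_nonneg (x4 - x2 - 2 / 5), sq_nonneg (x3 - x0 - 3 / 5), sq_nonneg (x4 - x1 - 3 / 5),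
    sq_nonneg (x4 - x0 - 4 / 5)]

theorem cov_fin (x : Fin 5 → ℝ) : ∃ n : Fin 5 → ℤ,
    5 * ∑ i, (x i - n i) ^ 2 - (∑ i, (x i - n i)) ^ 2 ≤ 2 := by
  let y : Fin 5 → ℝ := fun i => Int.fract (x i)
  let p := Tuple.sort y
  have hm : Monotone (y ∘ p) := Tuple.monotone_sort y
  obtain ⟨n0, n1, n2, n3, n4, h⟩ := cov_sorted (y (p 0)) (y (p 1)) (y (p 2)) (y (p 3)) (y (p 4))
    (Int.fract_nonneg _) (hm (by decide : (0 : Fin 5) ≤ 1)) (hm (by decide : (1 : Fin 5) ≤ 2))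
    (hm (by decide : (2 : Fin 5) ≤ 3)) (hm (by decide : (3 : Fin 5) ≤ 4)) (Int.fract_lt_one _).le
  let c : Fin 5 → ℤ := ![n0, n1, n2, n3, n4]
  refine ⟨fun i => ⌊x i⌋ + c (p.symm i), ?_⟩
  have e1 : ∑ i, (x i - ((⌊x i⌋ + c (p.symm i) : ℤ) : ℝ)) = ∑ i, (y (p i) - c i) := by
    rw [← Equiv.sum_comp p]
    refine Finset.sum_congr rfl fun i _ => ?_
    simp only [Equiv.symm_apply_apply, y, Int.fract]
    push_cast; ring
  have e2 : ∑ i, (x i - ((⌊x i⌋ + c (p.symm i) : ℤ) : ℝ)) ^ 2 = ∑ i, (y (p i) - c i) ^ 2 := by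
    rw [← Equiv.sum_comp p]
    refine Finset.sum_congr rfl fun i _ => ?_
    simp only [Equiv.symm_apply_apply, y, Int.fract]
    push_cast; ring
  rw [e1, e2]
  simp only [Fin.sum_univ_five]
  exact h

theorem normSq_form (w : ℂ) (hw : w ^ 5 = 1) (hc : (starRingEnd ℂ) w = w ^ 4)
    (z0 z1 z2 z3 z4 : ℝ) :
    ((Complex.normSq (z0 + z1 * w + z2 * w ^ 2 + z3 * w ^ 3 + z4 * w ^ 4) : ℝ) : ℂ) =
    z0 ^ 2 + z1 ^ 2 + z2 ^ 2 + z3 ^ 2 + z4 ^ 2 +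
    (w + w ^ 4) * (z0 * z1 + z1 * z2 + z2 * z3 + z3 * z4 + z4 * z0) +
    (w ^ 2 + w ^ 3) * (z0 * z2 + z1 * z3 + z2 * z4 + z3 * z0 + z4 * z1) := by
  have h2 : (w ^ 4) ^ 2 = w ^ 3 := by linear_combination w ^ 3 * hw
  have h3 : (w ^ 4) ^ 3 = w ^ 2 := by linear_combination (w ^ 7 + w ^ 2) * hw
  have h4 : (w ^ 4) ^ 4 = w := by linear_combination (w ^ 11 + w ^ 6 + w) * hw
  rw [← Complex.mul_conj]
  simp only [map_add, map_mul, map_pow, Complex.conj_ofReal, hc, h2, h3, h4]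
  grind

theorem rep {R K : Type} [CommRing R] [Field K] [Algebra R K] (ζ : K)
    (h : 1 + ζ + ζ ^ 2 + ζ ^ 3 + ζ ^ 4 = 0) (x : K) (hx : x ∈ Algebra.adjoin R {ζ}) :
    ∃ c0 c1 c2 c3 : R, x = algebraMap R K c0 + algebraMap R K c1 * ζ + algebraMap R K c2 * ζ ^ 2
      + algebraMap R K c3 * ζ ^ 3 := by
  induction hx using Algebra.adjoin_induction with
  | mem x hx => exact ⟨0, 1, 0, 0, by simp_all⟩
  | algebraMap r => exact ⟨r, 0, 0, 0, by simp⟩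
  | add x y _ _ hx hy =>
    obtain ⟨a0, a1, a2, a3, rfl⟩ := hx
    obtain ⟨b0, b1, b2, b3, rfl⟩ := hy
    exact ⟨a0 + b0, a1 + b1, a2 + b2, a3 + b3, by simp only [map_add]; ring⟩
  | mul x y _ _ hx hy =>
    obtain ⟨a0, a1, a2, a3, rfl⟩ := hx
    obtain ⟨b0, b1, b2, b3, rfl⟩ := hy
    have h5 : ζ ^ 5 = 1 := by linear_combination (ζ - 1) * h
    refine ⟨a0 * b0 + a2 * b3 + a3 * b2 - (a1 * b3 + a2 * b2 + a3 * b1),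
      a0 * b1 + a1 * b0 + a3 * b3 - (a1 * b3 + a2 * b2 + a3 * b1),
      a0 * b2 + a1 * b1 + a2 * b0 - (a1 * b3 + a2 * b2 + a3 * b1),
      a0 * b3 + a1 * b2 + a2 * b1 + a3 * b0 - (a1 * b3 + a2 * b2 + a3 * b1), ?_⟩
    simp only [map_add, map_sub, map_mul]
    generalize algebraMap R K a0 = a0
    generalize algebraMap R K a1 = a1
    generalize algebraMap R K a2 = a2
    generalize algebraMap R K a3 = a3
    generalize algebraMap R K b0 = b0
    generalize algebraMap R K b1 = b1
    generalize algebraMap R K b2 = b2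
    generalize algebraMap R K b3 = b3
    linear_combination (a1 * b3 + a2 * b2 + a3 * b1) * h + (a2 * b3 + a3 * b2 + a3 * b3 * ζ) * h5

theorem indep (ζ : CyclotomicField 5 ℚ) (hζ : IsPrimitiveRoot ζ 5) (c0 c1 c2 c3 : ℚ)
    (h : (c0 : CyclotomicField 5 ℚ) + c1 * ζ + c2 * ζ ^ 2 + c3 * ζ ^ 3 = 0) :
    c0 = 0 ∧ c1 = 0 ∧ c2 = 0 ∧ c3 = 0 := by
  have hm : minpoly ℚ ζ = Polynomial.cyclotomic 5 ℚ :=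
    (Polynomial.cyclotomic_eq_minpoly_rat hζ (by norm_num)).symm
  have hd : (minpoly ℚ ζ).natDegree = 4 := by
    rw [hm, Polynomial.natDegree_cyclotomic]; decide
  have hl := linearIndependent_pow (K := ℚ) ζ
  rw [hd, Fintype.linearIndependent_iff] at hl
  have := hl ![c0, c1, c2, c3] (by
    simp only [Fin.sum_univ_four, Algebra.smul_def, eq_ratCast]
    simpa using h)
  exact ⟨this 0, this 1, this 2, this 3⟩

theorem setup_exists (ζ : CyclotomicField 5 ℚ) (hζ : IsPrimitiveRoot ζ 5)
    (σ : CyclotomicField 5 ℚ ≃ₐ[ℚ] CyclotomicField 5 ℚ) (hσ : σ ζ = ζ⁻¹) :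
    ∃ (f g : CyclotomicField 5 ℚ →+* ℂ) (s t : ℝ),
      RedSetup (Algebra.adjoin ℤ {ζ}).toSubring (σ : CyclotomicField 5 ℚ →+* CyclotomicField 5 ℚ)
        (ζ ^ 2 + ζ ^ 3) f g s t := by
  have hcyc : IsCyclotomicExtension {5} ℚ (CyclotomicField 5 ℚ) :=
    CyclotomicField.isCyclotomicExtension 5 ℚ
  have h5 : ζ ^ 5 = 1 := hζ.pow_eq_one
  have hs : 1 + ζ + ζ ^ 2 + ζ ^ 3 + ζ ^ 4 = 0 := by
    have h1 : ζ - 1 ≠ 0 := sub_ne_zero.mpr (hζ.ne_one (by norm_num))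
    apply mul_left_cancel₀ h1
    linear_combination h5
  have hσ' : σ ζ = ζ ^ 4 := by
    rw [hσ]
    exact inv_eq_of_mul_eq_one_right (by rw [← h5]; ring)
  have hζS : ζ ∈ (Algebra.adjoin ℤ {ζ}).toSubring := Algebra.self_mem_adjoin_singleton ℤ ζ
  have repQ : ∀ x : CyclotomicField 5 ℚ, ∃ c0 c1 c2 c3 : ℚ,
      x = c0 + c1 * ζ + c2 * ζ ^ 2 + c3 * ζ ^ 3 := by
    intro x
    have := rep (R := ℚ) ζ hs x (by
      rw [IsCyclotomicExtension.adjoin_primitive_root_eq_top hζ]; trivial)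
    simpa using this
  have repZ : ∀ x ∈ (Algebra.adjoin ℤ {ζ}).toSubring, ∃ c0 c1 c2 c3 : ℤ,
      x = c0 + c1 * ζ + c2 * ζ ^ 2 + c3 * ζ ^ 3 := by
    intro x hx
    have := rep (R := ℤ) ζ hs x hx
    simpa using this
  have hinv : ∀ x, σ (σ x) = x := by
    intro x
    obtain ⟨c0, c1, c2, c3, rfl⟩ := repQ x
    simp only [map_add, map_mul, map_pow, map_ratCast, hσ']
    have : (ζ ^ 4) ^ 4 = ζ := by linear_combination (ζ ^ 11 + ζ ^ 6 + ζ) * h5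
    rw [this]
  have hirr : Irreducible (Polynomial.cyclotomic 5 ℚ) :=
    Polynomial.cyclotomic.irreducible_rat (by norm_num)
  have hemb : ∀ w : ℂ, IsPrimitiveRoot w 5 → ∃ f : CyclotomicField 5 ℚ →+* ℂ, f ζ = w := by
    intro w hw
    let E := hζ.embeddingsEquivPrimitiveRoots ℂ hirr
    refine ⟨(E.symm ⟨w, (mem_primitiveRoots (by norm_num)).mpr hw⟩ : _ →ₐ[ℚ] ℂ), ?_⟩
    have := hζ.embeddingsEquivPrimitiveRoots_apply_coe ℂ hirr
      (E.symm ⟨w, (mem_primitiveRoots (by norm_num)).mpr hw⟩)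
    rw [Equiv.apply_symm_apply] at this
    exact this.symm
  have hw0 : IsPrimitiveRoot (Complex.exp (2 * Real.pi * Complex.I / (5 : ℕ))) 5 :=
    Complex.isPrimitiveRoot_exp 5 (by norm_num)
  obtain ⟨f, hf⟩ := hemb _ hw0
  obtain ⟨g, hg⟩ := hemb _ (hw0.pow_of_coprime 2 (by norm_num))
  generalize Complex.exp (2 * Real.pi * Complex.I / (5 : ℕ)) = w at *
  have hw5 : w ^ 5 = 1 := hw0.pow_eq_one
  have hws : 1 + w + w ^ 2 + w ^ 3 + w ^ 4 = 0 := by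
    have := congrArg f hs
    simpa [hf] using this
  have hwc : (starRingEnd ℂ) w = w ^ 4 := by
    rw [← Complex.inv_eq_conj (Complex.norm_eq_one_of_pow_eq_one hw5 (by norm_num))]
    exact inv_eq_of_mul_eq_one_right (by rw [← hw5]; ring)
  have hwc2 : (starRingEnd ℂ) (w ^ 2) = (w ^ 2) ^ 4 := by rw [map_pow, hwc]; ring
  have hconj : ∀ (f : CyclotomicField 5 ℚ →+* ℂ) (w : ℂ), f ζ = w →
      (starRingEnd ℂ) w = w ^ 4 → ∀ x, f (σ x) = (starRingEnd ℂ) (f x) := by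
    intro f w hf hw x
    obtain ⟨c0, c1, c2, c3, rfl⟩ := repQ x
    simp only [map_add, map_mul, map_pow, map_ratCast, hσ', hf, hw]
  have hfc := hconj f w hf hwc
  have hgc := hconj g _ hg hwc2
  have htf : σ (ζ ^ 2 + ζ ^ 3) = ζ ^ 2 + ζ ^ 3 := by
    rw [map_add, map_pow, map_pow, hσ']
    linear_combination (ζ ^ 3 + ζ ^ 7 + ζ ^ 2) * h5
  have hft : f (ζ ^ 2 + ζ ^ 3) = w ^ 2 + w ^ 3 := by simp [hf]
  have hgt : g (ζ ^ 2 + ζ ^ 3) = w + w ^ 4 := by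
    simp only [map_add, map_pow, hg]; linear_combination w * hw5
  have hfr : f (ζ ^ 2 + ζ ^ 3) = ((f (ζ ^ 2 + ζ ^ 3)).re : ℂ) := by
    refine (Complex.conj_eq_iff_re.mp ?_).symm
    rw [← hfc, htf]
  have hgr : g (ζ ^ 2 + ζ ^ 3) = ((g (ζ ^ 2 + ζ ^ 3)).re : ℂ) := by
    refine (Complex.conj_eq_iff_re.mp ?_).symm
    rw [← hgc, htf]
  refine ⟨f, g, (f (ζ ^ 2 + ζ ^ 3)).re, (g (ζ ^ 2 + ζ ^ 3)).re, ⟨hinv, ?_, ?_, htf, ?_, ?_, hfr,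
    hgr, ?_, ?_, hfc, hgc, ?_⟩⟩
  · intro x hx
    obtain ⟨c0, c1, c2, c3, rfl⟩ := repZ x hx
    simp only [RingHom.coe_coe, map_add, map_mul, map_pow, map_intCast, hσ']
    have h4 := pow_mem hζS 4
    exact add_mem (add_mem (add_mem (intCast_mem _ _) (mul_mem (intCast_mem _ _) h4))
      (mul_mem (intCast_mem _ _) (pow_mem h4 2))) (mul_mem (intCast_mem _ _) (pow_mem h4 3))
  · exact add_mem (pow_mem hζS 2) (pow_mem hζS 3)
  · linear_combination (2 + ζ) * h5 + hs
  · intro a ha haf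
    obtain ⟨c0, c1, c2, c3, rfl⟩ := repZ a ha
    have h := haf
    simp only [RingHom.coe_coe, map_add, map_mul, map_pow, map_intCast, hσ'] at h
    have := indep ζ hζ c1 (2 * c1) (c1 + c2 - c3) (c1 + c3 - c2) (by
      push_cast
      linear_combination -h + (c1 : CyclotomicField 5 ℚ) * hs + (c2 * ζ ^ 3 + c3 * (ζ ^ 7 + ζ ^ 2)) * h5)
    obtain ⟨q1, -, q2, -⟩ := this
    have q1' : c1 = 0 := by exact_mod_cast q1
    have q2' : c1 + c2 - c3 = 0 := by exact_mod_cast q2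
    have q3 : c3 = c2 := by omega
    subst q1' q3
    refine ⟨c0, c3, ?_⟩
    push_cast
    ring
  · have : (((f (ζ ^ 2 + ζ ^ 3)).re + (g (ζ ^ 2 + ζ ^ 3)).re : ℝ) : ℂ) = ((-1 : ℝ) : ℂ) := by
      push_cast
      rw [← hfr, ← hgr, hft, hgt]
      linear_combination hws
    exact_mod_cast this
  · have : (((f (ζ ^ 2 + ζ ^ 3)).re * (g (ζ ^ 2 + ζ ^ 3)).re : ℝ) : ℂ) = ((-1 : ℝ) : ℂ) := by
      push_cast
      rw [← hfr, ← hgr, hft, hgt]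
      linear_combination hws + (w + w ^ 2) * hw5
    exact_mod_cast this
  · intro x
    obtain ⟨c0, c1, c2, c3, rfl⟩ := repQ x
    obtain ⟨n, hn⟩ := cov_fin ![(c0 : ℝ), c1, c2, c3, 0]
    refine ⟨n 0 + n 1 * ζ + n 2 * ζ ^ 2 + n 3 * ζ ^ 3 + n 4 * ζ ^ 4, ?_, ?_⟩
    · exact add_mem (add_mem (add_mem (add_mem (intCast_mem _ _) (mul_mem (intCast_mem _ _) hζS))
        (mul_mem (intCast_mem _ _) (pow_mem hζS 2))) (mul_mem (intCast_mem _ _) (pow_mem hζS 3)))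
        (mul_mem (intCast_mem _ _) (pow_mem hζS 4))
    · simp only [Fin.sum_univ_five] at hn
      have hn' : 5 * (((c0 : ℝ) - n 0) ^ 2 + (c1 - n 1) ^ 2 + (c2 - n 2) ^ 2 + (c3 - n 3) ^ 2
        + (0 - n 4) ^ 2) - (((c0 : ℝ) - n 0) + (c1 - n 1) + (c2 - n 2) + (c3 - n 3)
        + (0 - n 4)) ^ 2 ≤ 2 := hn
      have key : ∀ (f : CyclotomicField 5 ℚ →+* ℂ) (w : ℂ), f ζ = w →
        f (c0 + c1 * ζ + c2 * ζ ^ 2 + c3 * ζ ^ 3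
          - (n 0 + n 1 * ζ + n 2 * ζ ^ 2 + n 3 * ζ ^ 3 + n 4 * ζ ^ 4)) =
        ((c0 - n 0 : ℝ) : ℂ) + ((c1 - n 1 : ℝ) : ℂ) * w + ((c2 - n 2 : ℝ) : ℂ) * w ^ 2
          + ((c3 - n 3 : ℝ) : ℂ) * w ^ 3 + ((0 - n 4 : ℝ) : ℂ) * w ^ 4 := by
        intro f w hf
        simp only [map_add, map_sub, map_mul, map_pow, map_ratCast, map_intCast, hf]
        push_cast
        ring
      rw [key f w hf, key g _ hg]
      generalize (c0 - n 0 : ℝ) = z0 at *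
      generalize (c1 - n 1 : ℝ) = z1 at *
      generalize (c2 - n 2 : ℝ) = z2 at *
      generalize (c3 - n 3 : ℝ) = z3 at *
      generalize (0 - n 4 : ℝ) = z4 at *
      have e1 := normSq_form w hw5 hwc z0 z1 z2 z3 z4
      have e2 := normSq_form (w ^ 2) (by rw [← pow_mul, mul_comm, pow_mul, hw5, one_pow]) hwc2
        z0 z1 z2 z3 z4
      have e3 : ((Complex.normSq (z0 + z1 * w + z2 * w ^ 2 + z3 * w ^ 3 + z4 * w ^ 4) +
          Complex.normSq (z0 + z1 * w ^ 2 + z2 * (w ^ 2) ^ 2 + z3 * (w ^ 2) ^ 3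
            + z4 * (w ^ 2) ^ 4) : ℝ) : ℂ) =
          (((5 * (z0 ^ 2 + z1 ^ 2 + z2 ^ 2 + z3 ^ 2 + z4 ^ 2)
            - (z0 + z1 + z2 + z3 + z4) ^ 2) / 2 : ℝ) : ℂ) := by
        rw [Complex.ofReal_add, e1, e2]
        push_cast
        linear_combination (z0 * z1 + z1 * z2 + z2 * z3 + z3 * z4 + z4 * z0
          + z0 * z2 + z1 * z3 + z2 * z4 + z3 * z0 + z4 * z1) * hws +
          ((z0 * z1 + z1 * z2 + z2 * z3 + z3 * z4 + z4 * z0) * w ^ 3 +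
          (z0 * z2 + z1 * z3 + z2 * z4 + z3 * z0 + z4 * z1) * w) * hw5
      have e4 := Complex.ofReal_injective e3
      rw [e4]
      linarith



/-- Every totally positive unimodular 2×2 Hermitian matrix over `O = ℤ[ζ₅]`
decomposes as `C*·C` with `C` a matrix over `O` of unit determinant. -/
theorem stmt_0 (ζ : CyclotomicField 5 ℚ) (hζ : IsPrimitiveRoot ζ 5)
    (σ : CyclotomicField 5 ℚ ≃ₐ[ℚ] CyclotomicField 5 ℚ) (hσ : σ ζ = ζ⁻¹)
    (P : Matrix (Fin 2) (Fin 2) (CyclotomicField 5 ℚ))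
    -- the entries of `P` lie in `O = ℤ[ζ₅]`
    (hPO : ∀ i j, P i j ∈ Algebra.adjoin ℤ {ζ})
    -- `P` is Hermitian: `P* = P`
    (hHerm : (Matrix.of fun i j => σ (P j i)) = P)
    -- `P` is unimodular: `det P` is a unit of `O`
    (hUnimod : P.det ∈ Algebra.adjoin ℤ {ζ} ∧
      ∃ v ∈ Algebra.adjoin ℤ {ζ}, P.det * v = 1)
    -- `P` is totally positive: its image under every embedding `ψ : K → ℂ` is
    -- positive definite Hermitian
    (hPos : ∀ ψ : CyclotomicField 5 ℚ →+* ℂ, (P.map ψ).PosDef) :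
    ∃ C : Matrix (Fin 2) (Fin 2) (CyclotomicField 5 ℚ),
      (∀ i j, C i j ∈ Algebra.adjoin ℤ {ζ}) ∧
      (C.det ∈ Algebra.adjoin ℤ {ζ} ∧ ∃ w ∈ Algebra.adjoin ℤ {ζ}, C.det * w = 1) ∧
      P = (Matrix.of fun i j => σ (C j i)) * C := by
  obtain ⟨f, g, s, t, H⟩ := setup_exists ζ hζ σ hσ
  obtain ⟨hdS, v, hv, hdv⟩ := hUnimod
  have hij : ∀ i j, σ (P j i) = P i j := fun i j => congrFun (congrFun hHerm i) j
  have hdet : P.det = P 0 0 * P 1 1 - P 0 1 * σ (P 0 1) := by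
    rw [Matrix.det_fin_two, hij 1 0]
  have hp : ∀ f : CyclotomicField 5 ℚ →+* ℂ, 0 < (f (P 0 0)).re ∧ 0 < (f P.det).re := by
    intro f
    have h1 : 0 < f (P 0 0) := (hPos f).diag_pos (i := 0)
    have h2 := (hPos f).det_pos
    have h3 : (P.map f).det = f P.det := (RingHom.map_det f P).symm
    rw [h3] at h2
    exact ⟨(Complex.pos_iff.mp h1).1, (Complex.pos_iff.mp h2).1⟩
  obtain ⟨p, hp', q, hq, r, hr, u, hu, e1, e2, e3⟩ := H.main2 (hPO 0 0) (hPO 0 1) (hPO 1 1) hv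
    (hij 0 0) (hij 1 1) (by rw [← hdv, hdet]; rfl) (hp f).1 (hp g).1
    (by have := (hp f).2; rw [hdet] at this; exact this)
    (by have := (hp g).2; rw [hdet] at this; exact this)
  have hPC : P = (Matrix.of fun i j => σ (!![p, q; r, u] j i)) * !![p, q; r, u] := by
    have e4 : P 1 0 = σ q * p + σ u * r := by
      rw [← hij 1 0, e2]
      have h := H.invol
      simp only [RingHom.coe_coe] at h
      simp only [RingHom.coe_coe, map_add, map_mul, h]
      ring
    ext i j
    fin_cases i <;> fin_cases j <;> simp [Matrix.mul_apply, Fin.sum_univ_two]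
    · exact e1
    · exact e2
    · exact e4
    · exact e3
  have hCS : ∀ i j, !![p, q; r, u] i j ∈ Algebra.adjoin ℤ {ζ} := by
    intro i j
    fin_cases i <;> fin_cases j
    exacts [hp', hq, hr, hu]
  have hCd : (!![p, q; r, u]).det ∈ Algebra.adjoin ℤ {ζ} := by
    rw [Matrix.det_fin_two]
    exact sub_mem (mul_mem (hCS _ _) (hCS _ _)) (mul_mem (hCS _ _) (hCS _ _))
  refine ⟨!![p, q; r, u], hCS, ⟨hCd, σ (!![p, q; r, u]).det * v,
    mul_mem (H.stable _ hCd) hv, ?_⟩, hPC⟩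
  rw [← hdv, hdet, e1, e2, e3, Matrix.det_fin_two]
  have h := H.invol
  simp only [RingHom.coe_coe] at h
  simp [h]
  ring
end

section
/- For every element v of K = ℚ(ζ₅), there exists an element x of O = ℤ[ζ₅] such that the sum, over all four field embeddings ψ : K → ℂ, of |ψ(v − x)|² is at most 2. (Equivalently: the covering radius of the lattice (O, q), where q(x) = Tr_{K/ℚ}(x·σ(x)), is at most 2.) -/
noncomputable local instance : NumberField (CyclotomicField 5 ℚ) :=
  inferInstance

def QQ (b : Fin 5 → ℝ) : ℝ := ∑ i, ∑ j, (b i - b j)^2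

lemma gaps (p q r s t : ℝ) (p0 : 0 ≤ p) (q0 : 0 ≤ q) (r0 : 0 ≤ r) (s0 : 0 ≤ s) (t0 : 0 ≤ t)
    (ht : t = 1 - p - q - r - s) (X0 X1 X2 X3 X4 : ℝ)
    (E0 : X0 = 2*((p-(0))^2+((p+q)-(0))^2+((p+q)-(p))^2+((p+q+r)-(0))^2+((p+q+r)-(p))^2+((p+q+r)-((p+q)))^2+((p+q+r+s)-(0))^2+((p+q+r+s)-(p))^2+((p+q+r+s)-((p+q)))^2+((p+q+r+s)-((p+q+r)))^2)) (E1 : X1 = 2*((p-(0+1))^2+((p+q)-(0+1))^2+((p+q)-(p))^2+((p+q+r)-(0+1))^2+((p+q+r)-(p))^2+((p+q+r)-((p+q)))^2+((p+q+r+s)-(0+1))^2+((p+q+r+s)-(p))^2+((p+q+r+s)-((p+q)))^2+((p+q+r+s)-((p+q+r)))^2)) (E2 : X2 = 2*((p+1-(0+1))^2+((p+q)-(0+1))^2+((p+q)-(p+1))^2+((p+q+r)-(0+1))^2+((p+q+r)-(p+1))^2+((p+q+r)-((p+q)))^2+((p+q+r+s)-(0+1))^2+((p+q+r+s)-(p+1))^2+((p+q+r+s)-((p+q)))^2+((p+q+r+s)-((p+q+r)))^2))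 (E3 : X3 = 2*((p+1-(0+1))^2+((p+q)+1-(0+1))^2+((p+q)+1-(p+1))^2+((p+q+r)-(0+1))^2+((p+q+r)-(p+1))^2+((p+q+r)-((p+q)+1))^2+((p+q+r+s)-(0+1))^2+((p+q+r+s)-(p+1))^2+((p+q+r+s)-((p+q)+1))^2+((p+q+r+s)-((p+q+r)))^2)) (E4 : X4 = 2*((p+1-(0+1))^2+((p+q)+1-(0+1))^2+((p+q)+1-(p+1))^2+((p+q+r)+1-(0+1))^2+((p+q+r)+1-(p+1))^2+((p+q+r)+1-((p+q)+1))^2+((p+q+r+s)-(0+1))^2+((p+q+r+s)-(p+1))^2+((p+q+r+s)-((p+q)+1))^2+((p+q+r+s)-((p+q+r)+1))^2))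
    (H0 : 4 < X0) (H1 : 4 < X1) (H2 : 4 < X2) (H3 : 4 < X3) (H4 : 4 < X4) : False := by
  have K (g x : ℝ) (hg : 0 ≤ g) (hx : 4 < x) : 0 ≤ g * (x - 4) := mul_nonneg hg (by linarith)
  have k0 := K _ _ t0 H0
  have k1 := K _ _ p0 H1
  have k2 := K _ _ q0 H2
  have k3 := K _ _ r0 H3
  have k4 := K _ _ s0 H4
  have D (d e : ℝ) : d * (1 - d) ≤ e^2 + (1 - 2 * e) * d := by nlinarith [sq_nonneg (d - e)]
  have T : 2 * (p*(1-p)+q*(1-q)+r*(1-r)+s*(1-s)+t*(1-t)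
      + (p+q)*(1-(p+q)) + (q+r)*(1-(q+r)) + (r+s)*(1-(r+s)) + (s+t)*(1-(s+t)) + (t+p)*(1-(t+p)) - 2) ≤ 0 := by
    linarith [D p (1/5), D q (1/5), D r (1/5), D s (1/5), D t (1/5), D (p+q) (2/5),
        D (q+r) (2/5), D (r+s) (2/5), D (s+t) (2/5), D (t+p) (2/5)]
  have S : t * (X0 - 4) + p * (X1 - 4) + q * (X2 - 4) + r * (X3 - 4) + s * (X4 - 4) =
    2 * (p*(1-p)+q*(1-q)+r*(1-r)+s*(1-s)+t*(1-t)
      + (p+q)*(1-(p+q)) + (q+r)*(1-(q+r)) + (r+s)*(1-(r+s)) + (s+t)*(1-(s+t)) + (t+p)*(1-(t+p)) - 2) := by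
    rw [E0, E1, E2, E3, E4, ht]; ring
  have Z (g x : ℝ) (hx : 4 < x) (h : g * (x - 4) ≤ 0) : g ≤ 0 := by
    by_contra! hg
    have := mul_pos hg (sub_pos.2 hx)
    linarith
  have z0 := Z t _ H0 (by linarith)
  have z1 := Z p _ H1 (by linarith)
  have z2 := Z q _ H2 (by linarith)
  have z3 := Z r _ H3 (by linarith)
  have z4 := Z s _ H4 (by linarith)
  linarith

lemma sorted_case (b : Fin 5 → ℝ) (h01 : b 0 ≤ b 1) (h12 : b 1 ≤ b 2) (h23 : b 2 ≤ b 3)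
    (h34 : b 3 ≤ b 4) (h40 : b 4 ≤ b 0 + 1) :
    ∃ n : Fin 5 → ℤ, QQ (fun i => b i - n i) ≤ 4 := by
  by_contra! H
  have H0 := H ![0,0,0,0,0]
  have H1 := H ![-1,0,0,0,0]
  have H2 := H ![-1,-1,0,0,0]
  have H3 := H ![-1,-1,-1,0,0]
  have H4 := H ![-1,-1,-1,-1,0]
  simp [QQ, Fin.sum_univ_five] at H0 H1 H2 H3 H4
  obtain ⟨p, hp⟩ : ∃ p, p = b 1 - b 0 := ⟨_, rfl⟩
  obtain ⟨q, hq⟩ : ∃ q, q = b 2 - b 1 := ⟨_, rfl⟩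
  obtain ⟨r, hr⟩ : ∃ r, r = b 3 - b 2 := ⟨_, rfl⟩
  obtain ⟨s, hs⟩ : ∃ s, s = b 4 - b 3 := ⟨_, rfl⟩
  have e1 : b 1 = b 0 + p := by linarith
  have e2 : b 2 = b 0 + p + q := by linarith
  have e3 : b 3 = b 0 + p + q + r := by linarith
  have e4 : b 4 = b 0 + p + q + r + s := by linarith
  rw [e1, e2, e3, e4] at H0 H1 H2 H3 H4
  rw [e4] at h40
  refine gaps p q r s (1 - p - q - r - s) (by linarith) (by linarith) (by linarith) (by linarith)
    (by linarith) (by ring) _ _ _ _ _ ?_ ?_ ?_ ?_ ?_ H0 H1 H2 H3 H4 <;> ring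

lemma QQ_perm (b : Fin 5 → ℝ) (σ : Equiv.Perm (Fin 5)) : QQ (b ∘ σ) = QQ b := by
  unfold QQ
  simp only [Function.comp]
  rw [Equiv.sum_comp σ (fun i => ∑ j, (b i - b (σ j))^2)]
  exact Finset.sum_congr rfl fun i _ => Equiv.sum_comp σ (fun j => (b i - b j)^2)

lemma real_case (a : Fin 5 → ℝ) : ∃ n : Fin 5 → ℤ, QQ (fun i => a i - n i) ≤ 4 := by
  let b : Fin 5 → ℝ := fun i => Int.fract (a i)
  let σ := Tuple.sort b
  have hm : Monotone (b ∘ σ) := Tuple.monotone_sort b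
  obtain ⟨n, hn⟩ := sorted_case (b ∘ σ) (hm (by decide)) (hm (by decide)) (hm (by decide))
    (hm (by decide)) (by
      have h1 : b (σ 4) < 1 := Int.fract_lt_one _
      have h2 : 0 ≤ b (σ 0) := Int.fract_nonneg _
      simp only [Function.comp]; linarith)
  refine ⟨fun i => ⌊a i⌋ + n (σ.symm i), ?_⟩
  rw [← QQ_perm _ σ]
  convert hn using 2
  ext i
  simp only [Function.comp, b, Equiv.symm_apply_apply, ← Int.self_sub_floor]
  push_cast
  ring

lemma sum_emb (ζ : CyclotomicField 5 ℚ) (hζ : IsPrimitiveRoot ζ 5) (c : Fin 5 → ℚ) :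
    ∑ ψ : CyclotomicField 5 ℚ →+* ℂ, ‖ψ (∑ i, (c i : CyclotomicField 5 ℚ) * ζ ^ (i : ℕ))‖ ^ 2
      = QQ (fun i => (c i : ℝ)) / 2 := by
  have : IsCyclotomicExtension {5} ℚ (CyclotomicField 5 ℚ) := CyclotomicField.isCyclotomicExtension 5 ℚ
  have hirr : Irreducible (Polynomial.cyclotomic 5 ℚ) :=
    Polynomial.cyclotomic.irreducible_rat (by norm_num)
  let F : ℂ → ℝ := fun η => ‖∑ i : Fin 5, (c i : ℂ) * η ^ (i : ℕ)‖ ^ 2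
  have h1 : ∑ ψ : CyclotomicField 5 ℚ →+* ℂ, ‖ψ (∑ i, (c i : CyclotomicField 5 ℚ) * ζ ^ (i : ℕ))‖ ^ 2
      = ∑ η ∈ primitiveRoots 5 ℂ, F η := by
    rw [← Finset.sum_coe_sort (primitiveRoots 5 ℂ) F]
    refine Fintype.sum_equiv ((RingHom.equivRatAlgHom _ ℂ).trans (hζ.embeddingsEquivPrimitiveRoots ℂ hirr)) _ _ ?_
    intro ψ
    simp [F, map_sum]
  rw [h1]
  obtain ⟨e, he⟩ : ∃ e : ℂ, IsPrimitiveRoot e 5 := ⟨_, Complex.isPrimitiveRoot_exp 5 (by norm_num)⟩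
  have h5 : e ^ 5 = 1 := he.pow_eq_one
  have hs : 1 + e + e^2 + e^3 + e^4 = 0 := by
    have := he.geom_sum_eq_zero (by norm_num)
    simpa [Finset.sum_range_succ] using this
  have hset : primitiveRoots 5 ℂ = ({1,2,3,4} : Finset ℕ).image (fun k => e ^ k) := by
    ext x
    rw [mem_primitiveRoots (by norm_num), he.isPrimitiveRoot_iff]
    simp only [Finset.mem_image]
    constructor
    · rintro ⟨i, hi, hc, rfl⟩
      refine ⟨i, ?_, rfl⟩
      interval_cases i <;> simp_all
    · rintro ⟨i, hi, rfl⟩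
      refine ⟨i, ?_, ?_, rfl⟩ <;> · fin_cases hi <;> norm_num
  rw [hset, Finset.sum_image (by
    intro i hi j hj h
    refine he.pow_inj ?_ ?_ h
    · revert hi; simp; omega
    · revert hj; simp; omega)]
  have hce : (starRingEnd ℂ) e = e ^ 4 := by
    have hn : ‖e‖ = 1 := he.norm'_eq_one (by norm_num)
    rw [← Complex.inv_eq_conj hn]
    exact inv_eq_of_mul_eq_one_right (by rw [← h5]; ring)
  have h6 : e^6 = e := by rw [show e^6 = e^5*e by ring, h5, one_mul]
  have h8 : e^8 = e^3 := by rw [show e^8 = e^5*e^3 by ring, h5, one_mul]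
  have h9 : e^9 = e^4 := by rw [show e^9 = e^5*e^4 by ring, h5, one_mul]
  have h12 : e^12 = e^2 := by rw [show e^12 = e^5*e^5*e^2 by ring, h5]; ring
  have h16 : e^16 = e := by rw [show e^16 = e^5*e^5*e^5*e by ring, h5]; ring
  have hF (η : ℂ) (hη : (starRingEnd ℂ) η = η ^ 4) : ((F η : ℝ) : ℂ) =
      (c 0 + c 1 * η + c 2 * η^2 + c 3 * η^3 + c 4 * η^4) *
      (c 0 + c 1 * η^4 + c 2 * (η^4)^2 + c 3 * (η^4)^3 + c 4 * (η^4)^4) := by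
    simp only [F]
    push_cast
    rw [← Complex.mul_conj']
    simp [Fin.sum_univ_five, hη]
  apply Complex.ofReal_injective
  rw [Finset.sum_insert (by decide), Finset.sum_insert (by decide), Finset.sum_insert (by decide),
    Finset.sum_singleton]
  push_cast
  rw [hF, hF, hF, hF]
  rotate_left
  iterate 4 (simp only [map_pow, hce]; ring)
  simp only [QQ, Fin.sum_univ_five]
  push_cast
  generalize (c 0 : ℂ) = c0
  generalize (c 1 : ℂ) = c1
  generalize (c 2 : ℂ) = c2
  generalize (c 3 : ℂ) = c3
  generalize (c 4 : ℂ) = c4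
  have R (k : ℕ) (j : ℕ) (h : k = 5 * (k / 5) + j) : e ^ k = e ^ j := by
    conv_lhs => rw [h, pow_add, pow_mul, h5, one_pow, one_mul]
  simp only [← pow_mul, Nat.reduceMul, pow_one]
  have r6 := R 6 1 (by norm_num)
  have r8 := R 8 3 (by norm_num)
  have r9 := R 9 4 (by norm_num)
  have r12 := R 12 2 (by norm_num)
  have r16 := R 16 1 (by norm_num)
  have r24 := R 24 4 (by norm_num)
  have r32 := R 32 2 (by norm_num)
  have r36 := R 36 1 (by norm_num)
  have r48 := R 48 3 (by norm_num)
  have r64 := R 64 4 (by norm_num)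
  simp only [pow_zero, pow_one] at *
  simp only [r6,r8,r9,r12,r16,r24,r32,r36,r48,r64]
  grind

theorem stmt_1 (ζ : CyclotomicField 5 ℚ) (hζ : IsPrimitiveRoot ζ 5)
    (v : CyclotomicField 5 ℚ) :
    ∃ x ∈ Algebra.adjoin ℤ {ζ},
      ∑ ψ : CyclotomicField 5 ℚ →+* ℂ, ‖ψ (v - x)‖ ^ 2 ≤ 2 := by
  have : IsCyclotomicExtension {5} ℚ (CyclotomicField 5 ℚ) := CyclotomicField.isCyclotomicExtension 5 ℚ
  obtain ⟨c, rfl⟩ : ∃ c : Fin 5 → ℚ, v = ∑ i, (c i : CyclotomicField 5 ℚ) * ζ ^ (i : ℕ) := by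
    obtain ⟨f, hf, hv⟩ := (hζ.powerBasis ℚ).exists_eq_aeval v
    have hd : f.natDegree < 5 := by
      refine hf.trans ?_
      have : (hζ.powerBasis ℚ).dim = 4 := by
        rw [← PowerBasis.finrank, IsCyclotomicExtension.finrank (n := 5) _
          (Polynomial.cyclotomic.irreducible_rat (by norm_num))]
        decide
      omega
    refine ⟨fun i => f.coeff i, ?_⟩
    rw [hv, Polynomial.aeval_eq_sum_range' hd, Finset.sum_range]
    simp [Algebra.smul_def]
  obtain ⟨n, hn⟩ := real_case (fun i => (c i : ℝ))
  refine ⟨∑ i, (n i : CyclotomicField 5 ℚ) * ζ ^ (i : ℕ), ?_, ?_⟩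
  · refine sum_mem fun i _ => mul_mem ?_ (pow_mem (Algebra.self_mem_adjoin_singleton ℤ ζ) _)
    exact intCast_mem _ _
  · have := sum_emb ζ hζ (fun i => c i - n i)
    rw [← Finset.sum_sub_distrib]
    simp only [← sub_mul]
    push_cast at this
    rw [this]
    linarith
end

section
/- Let a and b be integers, and set α = a + bφ and α' = a + b(1−φ) (as real numbers). If α > 0, α' > 0, α·α' ≤ 3, α ≤ φ²·α', and α' ≤ φ²·α, then a = 1 and b = 0 (that is, the only totally positive element of ℤ[φ] of norm less than 4 satisfying the balance condition 1/φ² ≤ α/α' ≤ φ² is 1). -/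
/-- The case `b = ±1`, for an arbitrary real number `g ≥ 1`. -/
theorem stmt_5_aux (a : ℤ) (g : ℝ) (hg : 1 ≤ g) (hg2 : (2 * g - 1) ^ 2 < 3 * g ^ 2)
    (h2 : 0 < (a : ℝ) + 1 - g) (h3 : ((a : ℝ) + g) * (a + 1 - g) ≤ 3)
    (h4 : (a : ℝ) + g ≤ g ^ 2 * (a + 1 - g)) : False := by
  have hg3 : g < 3.74 := by nlinarith
  have ha0 : 0 < a := by
    have : (0 : ℝ) < a := by linarith
    exact_mod_cast this
  have ha4 : a < 4 := by
    by_contra h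
    have h' : (4 : ℝ) ≤ a := by exact_mod_cast not_lt.mp h
    nlinarith
  have hc : a = 1 ∨ a = 2 ∨ a = 3 := by omega
  rcases hc with rfl | rfl | rfl
  · push_cast at *
    nlinarith [mul_nonneg (by linarith : (0 : ℝ) ≤ g) (sq_nonneg (g - 1))]
  · push_cast at *
    have h : 2 < g := by nlinarith
    have : 0 < (g - 2) * (g ^ 2 - g - 1) := mul_pos (by linarith) (by nlinarith)
    nlinarith
  · push_cast at *
    have h : 3.5 < g := by nlinarith
    have : 0 ≤ (g - 3) * (g ^ 2 - g - 9) := mul_nonneg (by linarith) (by nlinarith)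
    nlinarith

/-- The only totally positive element of ℤ[φ] of norm at most 3 satisfying the
balance condition 1/φ² ≤ α/α' ≤ φ² is 1. -/
theorem stmt_5 (a b : ℤ) (α α' : ℝ)
    (hα : α = a + b * goldenRatio) (hα' : α' = a + b * (1 - goldenRatio))
    (h1 : 0 < α) (h2 : 0 < α') (h3 : α * α' ≤ 3)
    (h4 : α ≤ goldenRatio ^ 2 * α') (h5 : α' ≤ goldenRatio ^ 2 * α) :
    a = 1 ∧ b = 0 := by
  -- `goldenRatio` is an auto-bound real variable here; the claim holds for every real value.
  rename' goldenRatio => g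
  have hg1 : 1 ≤ g ^ 2 := by
    by_contra h
    push Not at h
    nlinarith
  have hA : α ^ 2 ≤ 3 * g ^ 2 := by nlinarith
  have hB : α' ^ 2 ≤ 3 * g ^ 2 := by nlinarith
  have hD : (α - α') ^ 2 < 3 * g ^ 2 := by
    rcases le_total α α' with h | h <;> nlinarith
  have hE : (b : ℝ) ^ 2 * (2 * g - 1) ^ 2 < 3 * g ^ 2 := by
    have : α - α' = b * (2 * g - 1) := by rw [hα, hα']; ring
    rw [this, mul_pow] at hD
    exact hD
  by_cases hb : b = 0
  · subst hb
    simp only [Int.cast_zero, zero_mul, add_zero] at hα hα'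
    subst hα
    subst hα'
    have p1 : 0 < a := by exact_mod_cast h1
    have p2 : a * a ≤ 3 := by exact_mod_cast h3
    refine ⟨?_, rfl⟩
    nlinarith
  · exfalso
    have hb1 : (1 : ℝ) ≤ (b : ℝ) ^ 2 := by
      have : 0 < b ^ 2 := by positivity
      exact_mod_cast this
    have hF : (2 * g - 1) ^ 2 < 3 * g ^ 2 := by nlinarith [sq_nonneg (2 * g - 1)]
    have hg : 1 ≤ g := by
      by_contra h
      have : g ≤ -1 := by
        by_contra h'
        push Not at h h'
        nlinarith
      nlinarith
    have hb2 : b ^ 2 < 4 := by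
      by_contra h
      have h' : (4 : ℝ) ≤ (b : ℝ) ^ 2 := by exact_mod_cast not_lt.mp h
      nlinarith [sq_nonneg (2 * g - 1)]
    have u : b < 2 := by nlinarith
    have l : -2 < b := by nlinarith
    have hc : b = 1 ∨ b = -1 := by omega
    subst hα
    subst hα'
    rcases hc with rfl | rfl
    · push_cast at *
      exact stmt_5_aux a g hg hF (by linarith) (by linarith) (by linarith)
    · push_cast at *
      refine stmt_5_aux (a - 1) g hg hF ?_ ?_ ?_ <;> push_cast <;> linarith
end

section
/- Let ζ be a primitive 5th root of unity in the cyclotomic field K = ℚ(ζ₅), and set π = ζ² + 2ζ − 2 and π̄ = ζ³ + 2ζ⁴ − 2 (the image of π under the automorphism ζ ↦ ζ⁻¹). Then π⁴ + 11π³ + 51π² + 121π + 121 = 0 and π·π̄ = 11. -/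
/-- With `π = ζ² + 2ζ − 2` and `π̄ = ζ³ + 2ζ⁴ − 2` in `ℚ(ζ₅)`, the element `π` is a
root of `x⁴ + 11x³ + 51x² + 121x + 121` and `π·π̄ = 11`. -/
theorem stmt_8 (ζ : CyclotomicField 5 ℚ) (hζ : IsPrimitiveRoot ζ 5) :
    (ζ ^ 2 + 2 * ζ - 2) ^ 4 + 11 * (ζ ^ 2 + 2 * ζ - 2) ^ 3 +
        51 * (ζ ^ 2 + 2 * ζ - 2) ^ 2 + 121 * (ζ ^ 2 + 2 * ζ - 2) + 121 = 0 ∧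
      (ζ ^ 2 + 2 * ζ - 2) * (ζ ^ 3 + 2 * ζ ^ 4 - 2) = 11 := by
  have h : 1 + ζ + ζ ^ 2 + ζ ^ 3 + ζ ^ 4 = 0 := by
    have := hζ.geom_sum_eq_zero (by norm_num)
    simpa [Finset.sum_range_succ] using this
  constructor
  · linear_combination ((11)*ζ^0+(23)*ζ^1+(19)*ζ^2+(7)*ζ^3+(1)*ζ^4) * h
  · linear_combination ((-7)*ζ^0+(3)*ζ^1+(2)*ζ^2) * h
end

section
/- Let ζ be a primitive 5th root of unity in the cyclotomic field K = ℚ(ζ₅), and set π = ζ² + 2ζ − 2 and π̄ = ζ³ + 2ζ⁴ − 2. Then the subring ℤ[π, π̄] of K generated over ℤ by π and π̄ equals the subring ℤ[ζ]; that is, the ℤ-algebra generated by {π, π̄} coincides with the ℤ-algebra generated by {ζ}, which is the full ring of integers of K. -/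
/-- With `π = ζ² + 2ζ − 2` and `π̄ = ζ³ + 2ζ⁴ − 2` in `K = ℚ(ζ₅)`, the subring
`ℤ[π, π̄]` equals `ℤ[ζ]`, which is the full ring of integers of `K`. -/
theorem stmt_9 (ζ : CyclotomicField 5 ℚ) (hζ : IsPrimitiveRoot ζ 5) :
    Algebra.adjoin ℤ ({ζ ^ 2 + 2 * ζ - 2, ζ ^ 3 + 2 * ζ ^ 4 - 2} :
        Set (CyclotomicField 5 ℚ)) = Algebra.adjoin ℤ {ζ} ∧
      Algebra.adjoin ℤ ({ζ} : Set (CyclotomicField 5 ℚ)) =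
        integralClosure ℤ (CyclotomicField 5 ℚ) := by
  have h5 : ζ ^ 5 = 1 := hζ.pow_eq_one
  have hs : ζ ^ 4 + ζ ^ 3 + ζ ^ 2 + ζ + 1 = 0 := by
    have h1 : ζ - 1 ≠ 0 := sub_ne_zero.mpr (hζ.ne_one (by norm_num))
    apply mul_left_cancel₀ h1
    linear_combination h5
  refine ⟨le_antisymm ?_ ?_, ?_⟩
  · have hz : ζ ∈ Algebra.adjoin ℤ ({ζ} : Set (CyclotomicField 5 ℚ)) :=
      Algebra.self_mem_adjoin_singleton ℤ ζ
    have h2 : (2 : CyclotomicField 5 ℚ) ∈ Algebra.adjoin ℤ ({ζ} : Set (CyclotomicField 5 ℚ)) :=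
      ofNat_mem _ 2
    refine Algebra.adjoin_le ?_
    rintro x (rfl | rfl)
    · exact sub_mem (add_mem (pow_mem hz 2) (mul_mem h2 hz)) h2
    · exact sub_mem (add_mem (pow_mem hz 3) (mul_mem h2 (pow_mem hz 4))) h2
  · refine Algebra.adjoin_le ?_
    rintro x rfl
    set A := Algebra.adjoin ℤ ({x ^ 2 + 2 * x - 2, x ^ 3 + 2 * x ^ 4 - 2} :
        Set (CyclotomicField 5 ℚ)) with hA
    have ha : x ^ 2 + 2 * x - 2 ∈ A := Algebra.subset_adjoin (by simp)
    have hb : x ^ 3 + 2 * x ^ 4 - 2 ∈ A := Algebra.subset_adjoin (by simp)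
    have e : x = (x ^ 3 + 2 * x ^ 4 - 2) ^ 2 + 8 * (x ^ 3 + 2 * x ^ 4 - 2)
        + 4 * (x ^ 2 + 2 * x - 2) + 28 := by
      linear_combination (-x - 4 * x ^ 2 - 4 * x ^ 3) * h5 - 8 * hs
    have h8 : (8 : CyclotomicField 5 ℚ) ∈ A := ofNat_mem _ 8
    have h4 : (4 : CyclotomicField 5 ℚ) ∈ A := ofNat_mem _ 4
    have h28 : (28 : CyclotomicField 5 ℚ) ∈ A := ofNat_mem _ 28
    have := add_mem (add_mem (add_mem (pow_mem hb 2) (mul_mem h8 hb)) (mul_mem h4 ha)) h28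
    rw [← e] at this
    exact this
  · have : Fact (Nat.Prime 5) := ⟨by norm_num⟩
    have hc : IsCyclotomicExtension {5} ℚ (CyclotomicField 5 ℚ) := by
      convert! CyclotomicField.isCyclotomicExtension 5 ℚ
    have hI := IsCyclotomicExtension.Rat.isIntegralClosure_adjoin_singleton_of_prime (p := 5) hζ
    ext x
    rw [mem_integralClosure_iff]
    have := hI.isIntegral_iff (x := x)
    convert! this.symm using 1
    exact ⟨fun h => ⟨⟨x, h⟩, rfl⟩, by rintro ⟨y, rfl⟩; exact y.2⟩
end

section
/- Let K = ℚ(ζ₅) with ζ a primitive 5th root of unity and σ the automorphism of K determined by σ(ζ) = ζ⁻¹. There exists an element π of the ring of integers ℤ[ζ] of K such that π⁴ + 29π³ + 331π² + 1769π + 3721 = 0, π·σ(π) = 61, and the subring ℤ[π, σ(π)] of K equals ℤ[ζ]. -/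
/-- There is an element `π` of `ℤ[ζ₅]` with
`π⁴ + 29π³ + 331π² + 1769π + 3721 = 0`, `π·σ(π) = 61`, and `ℤ[π, σ(π)] = ℤ[ζ₅]`,
where `σ` is the automorphism of `ℚ(ζ₅)` with `σ(ζ) = ζ⁻¹`. -/
theorem stmt_10 (ζ : CyclotomicField 5 ℚ) (hζ : IsPrimitiveRoot ζ 5)
    (σ : CyclotomicField 5 ℚ ≃ₐ[ℚ] CyclotomicField 5 ℚ) (hσ : σ ζ = ζ⁻¹) :
    ∃ π : CyclotomicField 5 ℚ, π ∈ Algebra.adjoin ℤ {ζ} ∧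
      π ^ 4 + 29 * π ^ 3 + 331 * π ^ 2 + 1769 * π + 3721 = 0 ∧
      π * σ π = 61 ∧
      Algebra.adjoin ℤ ({π, σ π} : Set (CyclotomicField 5 ℚ)) =
        Algebra.adjoin ℤ {ζ} := by
  have h5 : ζ ^ 5 = 1 := hζ.pow_eq_one
  have h0 : ζ ^ 4 + ζ ^ 3 + ζ ^ 2 + ζ + 1 = 0 := by
    have h1 : ζ - 1 ≠ 0 := sub_ne_zero.mpr (hζ.ne_one (by norm_num))
    apply mul_left_cancel₀ h1
    linear_combination h5
  have hinv : ζ⁻¹ = ζ ^ 4 := by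
    apply inv_eq_of_mul_eq_one_right
    linear_combination h5
  have hs : σ (-6 + 3 * ζ + 2 * ζ ^ 2) = -6 + 3 * ζ ^ 4 + 2 * ζ ^ 3 := by
    simp only [map_add, map_mul, map_pow, map_neg, map_ofNat, hσ, hinv]
    linear_combination 2 * ζ ^ 3 * h5
  have hz : ζ ∈ Algebra.adjoin ℤ ({ζ} : Set (CyclotomicField 5 ℚ)) :=
    Algebra.subset_adjoin rfl
  have hn : ∀ (S : Subalgebra ℤ (CyclotomicField 5 ℚ)) (n : ℕ) [n.AtLeastTwo],
      (OfNat.ofNat n : CyclotomicField 5 ℚ) ∈ S := fun S n _ => ofNat_mem S n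
  have hp : -6 + 3 * ζ + 2 * ζ ^ 2 ∈ Algebra.adjoin ℤ ({ζ} : Set (CyclotomicField 5 ℚ)) :=
    add_mem (add_mem (neg_mem (hn _ 6)) (mul_mem (hn _ 3) hz)) (mul_mem (hn _ 2) (pow_mem hz 2))
  have hq : -6 + 3 * ζ ^ 4 + 2 * ζ ^ 3 ∈ Algebra.adjoin ℤ ({ζ} : Set (CyclotomicField 5 ℚ)) :=
    add_mem (add_mem (neg_mem (hn _ 6)) (mul_mem (hn _ 3) (pow_mem hz 4)))
      (mul_mem (hn _ 2) (pow_mem hz 3))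
  have hmul : (-6 + 3 * ζ + 2 * ζ ^ 2) * (-6 + 3 * ζ ^ 4 + 2 * ζ ^ 3) = 61 := by
    grind
  have hadd : ((-6 + 3 * ζ + 2 * ζ ^ 2) + (-6 + 3 * ζ ^ 4 + 2 * ζ ^ 3)) = -14 + ζ + ζ ^ 4 := by
    grind
  refine ⟨-6 + 3 * ζ + 2 * ζ ^ 2, hp, ?_, ?_, ?_⟩
  · grind
  · rw [hs]; exact hmul
  · rw [hs]
    apply le_antisymm
    · apply Algebra.adjoin_le
      rintro x (rfl | rfl)
      · exact hp
      · exact hq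
    · apply Algebra.adjoin_le
      rintro x rfl
      have ha := Algebra.subset_adjoin (R := ℤ)
        (s := ({-6 + 3 * x + 2 * x ^ 2, -6 + 3 * x ^ 4 + 2 * x ^ 3} : Set (CyclotomicField 5 ℚ)))
        (Set.mem_insert _ _)
      have hb := Algebra.subset_adjoin (R := ℤ)
        (s := ({-6 + 3 * x + 2 * x ^ 2, -6 + 3 * x ^ 4 + 2 * x ^ 3} : Set (CyclotomicField 5 ℚ)))
        (Set.mem_insert_of_mem _ rfl)
      have hc := mul_mem (add_mem (mul_mem (hn _ 2) (add_mem ha hb)) (hn _ 27))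
        (add_mem ha (hn _ 8))
      have he : (2 * ((-6 + 3 * x + 2 * x ^ 2) + (-6 + 3 * x ^ 4 + 2 * x ^ 3)) + 27) *
          ((-6 + 3 * x + 2 * x ^ 2) + 8) = x := by
        rw [hadd]
        grind
      rw [he] at hc
      exact hc
end
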